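/- (Theorem 1.) Let P̂ be a second transition dynamics satisfying E_{(s,a)∼d_{π_n} π_n}[D_TV(P̂_{s,a}, P_{s,a})] ≤ δ for a given policy π_n and δ ≥ 0. Fix α ≥ 0 and let T = {π : E_{s∼d_{π_n}}[D_TV(π(·|s), π_n(·|s))] ≤ α} (with d_{π_n} the visitation distribution under the true dynamics P). Suppose η_n minimizes Ĵ over T (Ĵ being expected discounted cost under P̂), let η*_n minimize J over T, and set Δ_n(α) = J(π_n) − J(η*_n). Then J(η_n) ≤ J(π_n) − Δ_n(α) + 2γδ/(1−γ)² + 8γα/(1−γ)³. -/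

import Mathlib

open scoped BigOperators

noncomputable section

/-- `p` is a probability distribution on a finite type. -/
def IsDist {X : Type*} [Fintype X] (p : X → ℝ) : Prop :=
  (∀ x, 0 ≤ p x) ∧ ∑ x, p x = 1

/-- `P` is a transition dynamics: `P s a` is a distribution over next states. -/
def IsDynamics {S A : Type*} [Fintype S] (P : S → A → S → ℝ) : Prop :=
  ∀ s a, IsDist (P s a)

/-- `π` is a (stochastic) policy: `π s` is a distribution over actions. -/
def IsPolicy {S A : Type*} [Fintype A] (π : S → A → ℝ) : Prop :=
  ∀ s, IsDist (π s)

/-- One-step evolution of a state distribution under policy `π` and dynamics `P`. -/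
def step {S A : Type*} [Fintype S] [Fintype A]
    (P : S → A → S → ℝ) (π : S → A → ℝ) (d : S → ℝ) : S → ℝ :=
  fun s' => ∑ s, ∑ a, d s * π s a * P s a s'

/-- The time-`t` state distribution `d_π^t` starting from `ρ₀`. -/
def stateDist {S A : Type*} [Fintype S] [Fintype A]
    (P : S → A → S → ℝ) (π : S → A → ℝ) (ρ₀ : S → ℝ) : ℕ → S → ℝ
  | 0 => ρ₀
  | t + 1 => step P π (stateDist P π ρ₀ t)

/-- Discounted state visitation distribution `d_π = (1-γ) Σ_t γ^t d_π^t`. -/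
def visit {S A : Type*} [Fintype S] [Fintype A]
    (γ : ℝ) (P : S → A → S → ℝ) (π : S → A → ℝ) (ρ₀ : S → ℝ) : S → ℝ :=
  fun s => (1 - γ) * ∑' t : ℕ, γ ^ t * stateDist P π ρ₀ t s

/-- Expected cost of one step when the state is distributed as `d` and actions follow `π`. -/
def expCost {S A : Type*} [Fintype S] [Fintype A]
    (c : S → A → ℝ) (π : S → A → ℝ) (d : S → ℝ) : ℝ :=
  ∑ s, ∑ a, d s * π s a * c s a

/-- Value function `V^π(s₀)`: expected total discounted cost starting at `s₀`. -/
def Vf {S A : Type*} [Fintype S] [Fintype A] [DecidableEq S]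
    (γ : ℝ) (P : S → A → S → ℝ) (c : S → A → ℝ) (π : S → A → ℝ) (s₀ : S) : ℝ :=
  ∑' t : ℕ, γ ^ t * expCost c π (stateDist P π (fun s => if s = s₀ then 1 else 0) t)

/-- Objective `J(π) = E_{s∼ρ₀}[V^π(s)]`. -/
def Jf {S A : Type*} [Fintype S] [Fintype A] [DecidableEq S]
    (γ : ℝ) (P : S → A → S → ℝ) (c : S → A → ℝ) (ρ₀ : S → ℝ) (π : S → A → ℝ) : ℝ :=
  ∑ s, ρ₀ s * Vf γ P c π s

/-- State-action value `Q^π(s,a) = c(s,a) + γ E_{s'∼P_{s,a}}[V^π(s')]`. -/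
def Qf {S A : Type*} [Fintype S] [Fintype A] [DecidableEq S]
    (γ : ℝ) (P : S → A → S → ℝ) (c : S → A → ℝ) (π : S → A → ℝ) (s : S) (a : A) : ℝ :=
  c s a + γ * ∑ s', P s a s' * Vf γ P c π s'

/-- Disadvantage function `A^π(s,a) = Q^π(s,a) - V^π(s)`. -/
def Adv {S A : Type*} [Fintype S] [Fintype A] [DecidableEq S]
    (γ : ℝ) (P : S → A → S → ℝ) (c : S → A → ℝ) (π : S → A → ℝ) (s : S) (a : A) : ℝ :=
  Qf γ P c π s a - Vf γ P c π s

section Dynamics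

variable {S A : Type*} [Fintype S] [Fintype A]

theorem IsDist.le_one {X : Type*} [Fintype X] {p : X → ℝ} (hp : IsDist p) (x : X) : p x ≤ 1 :=
  hp.2 ▸ Finset.single_le_sum (fun i _ => hp.1 i) (Finset.mem_univ x)

theorem isDist_ite_eq [DecidableEq S] (x : S) : IsDist (fun s => if s = x then (1 : ℝ) else 0) :=
  ⟨fun s => by dsimp only; split_ifs <;> norm_num, by simp⟩

/-- Averages of `f` over two distributions differ by at most their total variation distance times
the length of an interval containing the values of `f`. -/
theorem IsDist.abs_sum_sub_mul_le {X : Type*} [Fintype X] {p q : X → ℝ} (hp : IsDist p)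
    (hq : IsDist q) {f : X → ℝ} {M : ℝ} (hf : ∀ x, 0 ≤ f x ∧ f x ≤ M) :
    |∑ x, (p x - q x) * f x| ≤ M * ((∑ x, |p x - q x|) / 2) := by
  have hcenter : ∑ x, (p x - q x) * f x = ∑ x, (p x - q x) * (f x - M / 2) := by
    simp only [mul_sub, Finset.sum_sub_distrib, ← Finset.sum_mul, hp.2, hq.2]
    ring
  rw [hcenter]
  calc |∑ x, (p x - q x) * (f x - M / 2)|
      ≤ ∑ x, |(p x - q x) * (f x - M / 2)| := Finset.abs_sum_le_sum_abs _ _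
    _ ≤ ∑ x, |p x - q x| * (M / 2) := by
        refine Finset.sum_le_sum fun x _ => ?_
        rw [abs_mul]
        refine mul_le_mul_of_nonneg_left ?_ (abs_nonneg _)
        rw [abs_le]
        constructor <;> linarith [(hf x).1, (hf x).2]
    _ = M * ((∑ x, |p x - q x|) / 2) := by
        rw [← Finset.sum_mul]
        ring

theorem IsDist.half_sum_abs_sub_le_one {X : Type*} [Fintype X] {p q : X → ℝ} (hp : IsDist p)
    (hq : IsDist q) : (∑ x, |p x - q x|) / 2 ≤ 1 := by
  have h : ∑ x, |p x - q x| ≤ ∑ x, (p x + q x) := by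
    refine Finset.sum_le_sum fun x _ => ?_
    rw [abs_le]
    constructor <;> linarith [hp.1 x, hq.1 x]
  rw [Finset.sum_add_distrib, hp.2, hq.2] at h
  linarith

/-- Summing `step P π d` against a test function. -/
theorem sum_step_mul (P : S → A → S → ℝ) (π : S → A → ℝ) (d f : S → ℝ) :
    ∑ s', step P π d s' * f s' = ∑ s, ∑ a, d s * π s a * ∑ s', P s a s' * f s' := by
  simp only [step, Finset.sum_mul, Finset.mul_sum]
  rw [Finset.sum_comm]
  refine Finset.sum_congr rfl fun s _ => ?_
  rw [Finset.sum_comm]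
  simp only [mul_assoc]

theorem IsDist.step {P : S → A → S → ℝ} {π : S → A → ℝ} {d : S → ℝ} (hP : IsDynamics P)
    (hπ : IsPolicy π) (hd : IsDist d) : IsDist (step P π d) := by
  refine ⟨fun s' => Finset.sum_nonneg fun s _ => Finset.sum_nonneg fun a _ =>
    mul_nonneg (mul_nonneg (hd.1 s) ((hπ s).1 a)) ((hP s a).1 s'), ?_⟩
  have h := sum_step_mul P π d 1
  simpa [(hP _ _).2, ← Finset.mul_sum, (hπ _).2, hd.2] using h

theorem IsDist.stateDist {P : S → A → S → ℝ} {π : S → A → ℝ} {ρ : S → ℝ} (hP : IsDynamics P)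
    (hπ : IsPolicy π) (hρ : IsDist ρ) (t : ℕ) : IsDist (stateDist P π ρ t) := by
  induction t with
  | zero => exact hρ
  | succ t ih => exact ih.step hP hπ

theorem summable_discounted {γ : ℝ} (hγ : 0 ≤ γ) (hγ' : γ < 1) {u : ℕ → ℝ}
    (hu : ∀ t, 0 ≤ u t ∧ u t ≤ 1) : Summable fun t => γ ^ t * u t :=
  Summable.of_nonneg_of_le (fun t => mul_nonneg (pow_nonneg hγ t) (hu t).1)
    (fun t => mul_le_of_le_one_right (pow_nonneg hγ t) (hu t).2)
    (summable_geometric_of_lt_one hγ hγ')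

theorem summable_discounted_stateDist {γ : ℝ} (hγ : 0 ≤ γ) (hγ' : γ < 1) {P : S → A → S → ℝ}
    {π : S → A → ℝ} {ρ : S → ℝ} (hP : IsDynamics P) (hπ : IsPolicy π) (hρ : IsDist ρ) (s : S) :
    Summable fun t => γ ^ t * stateDist P π ρ t s :=
  summable_discounted hγ hγ' fun t =>
    ⟨(hρ.stateDist hP hπ t).1 s, (hρ.stateDist hP hπ t).le_one s⟩

theorem IsDist.visit {γ : ℝ} (hγ : 0 ≤ γ) (hγ' : γ < 1) {P : S → A → S → ℝ}
    {π : S → A → ℝ} {ρ : S → ℝ} (hP : IsDynamics P) (hπ : IsPolicy π) (hρ : IsDist ρ) :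
    IsDist (visit γ P π ρ) := by
  refine ⟨fun s => mul_nonneg (by linarith) (tsum_nonneg fun t =>
    mul_nonneg (pow_nonneg hγ t) ((hρ.stateDist hP hπ t).1 s)), ?_⟩
  simp only [_root_.visit]
  rw [← Finset.mul_sum,
    ← Summable.tsum_finsetSum fun s _ => summable_discounted_stateDist hγ hγ' hP hπ hρ s]
  simp only [← Finset.mul_sum, (hρ.stateDist hP hπ _).2, mul_one]
  rw [tsum_geometric_of_lt_one hγ hγ']
  exact mul_inv_cancel₀ (by linarith)

/-- The flow equation of the discounted visitation distribution. -/
theorem visit_eq_add_step {γ : ℝ} (hγ : 0 ≤ γ) (hγ' : γ < 1) {P : S → A → S → ℝ}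
    {π : S → A → ℝ} {ρ : S → ℝ} (hP : IsDynamics P) (hπ : IsPolicy π) (hρ : IsDist ρ) (s' : S) :
    visit γ P π ρ s' = (1 - γ) * ρ s' + γ * step P π (visit γ P π ρ) s' := by
  have hsum := summable_discounted_stateDist hγ hγ' hP hπ hρ
  have htail : ∑' t : ℕ, γ ^ (t + 1) * stateDist P π ρ (t + 1) s'
      = γ * ∑ s, ∑ a, (∑' t : ℕ, γ ^ t * stateDist P π ρ t s) * π s a * P s a s' := by
    have hterm : ∀ t : ℕ, γ ^ (t + 1) * stateDist P π ρ (t + 1) s'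
        = γ * ∑ s, ∑ a, γ ^ t * stateDist P π ρ t s * π s a * P s a s' := by
      intro t
      simp only [stateDist, step, Finset.mul_sum]
      refine Finset.sum_congr rfl fun s _ => Finset.sum_congr rfl fun a _ => ?_
      ring
    have hsa : ∀ s a, Summable fun t => γ ^ t * stateDist P π ρ t s * π s a * P s a s' :=
      fun s a => ((hsum s).mul_right _).mul_right _
    simp only [hterm]
    rw [tsum_mul_left, Summable.tsum_finsetSum fun s _ => summable_sum fun a _ => hsa s a]
    congr 1
    refine Finset.sum_congr rfl fun s _ => ?_
    rw [Summable.tsum_finsetSum fun a _ => hsa s a]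
    simp only [tsum_mul_right]
  have hstep : step P π (visit γ P π ρ) s' = (1 - γ) *
      ∑ s, ∑ a, (∑' t : ℕ, γ ^ t * stateDist P π ρ t s) * π s a * P s a s' := by
    simp only [step, visit, Finset.mul_sum, mul_assoc]
  rw [hstep, visit, (hsum s').tsum_eq_zero_add, htail]
  simp only [pow_zero, one_mul, stateDist]
  ring

/-- State-action visitation distributions of two policies are close in `ℓ¹` when the policies are
close in expected total variation. -/
theorem sum_abs_visit_mul_sub_le {γ : ℝ} (hγ : 0 ≤ γ) (hγ' : γ < 1)
    {P : S → A → S → ℝ} {π η : S → A → ℝ} {ρ : S → ℝ}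
    (hP : IsDynamics P) (hπ : IsPolicy π) (hη : IsPolicy η) (hρ : IsDist ρ) {α : ℝ}
    (hα : ∑ s, visit γ P π ρ s * ((∑ a, |η s a - π s a|) / 2) ≤ α) :
    ∑ s, ∑ a, |visit γ P η ρ s * η s a - visit γ P π ρ s * π s a| ≤ 2 * α / (1 - γ) := by
  have hjoint : ∑ s, ∑ a, |visit γ P η ρ s * η s a - visit γ P π ρ s * π s a|
      ≤ ∑ s, |visit γ P η ρ s - visit γ P π ρ s| + 2 * α := by
    calc ∑ s, ∑ a, |visit γ P η ρ s * η s a - visit γ P π ρ s * π s a|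
        ≤ ∑ s, ∑ a, (|visit γ P η ρ s - visit γ P π ρ s| * η s a
            + visit γ P π ρ s * |η s a - π s a|) := by
          refine Finset.sum_le_sum fun s _ => Finset.sum_le_sum fun a _ => ?_
          have hsplit : visit γ P η ρ s * η s a - visit γ P π ρ s * π s a =
              (visit γ P η ρ s - visit γ P π ρ s) * η s a
                + visit γ P π ρ s * (η s a - π s a) := by ring
          rw [hsplit]
          refine (abs_add_le _ _).trans_eq ?_
          rw [abs_mul, abs_mul, abs_of_nonneg ((hη s).1 a),
            abs_of_nonneg ((hρ.visit hγ hγ' hP hπ).1 s)]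
      _ = ∑ s, |visit γ P η ρ s - visit γ P π ρ s|
            + 2 * ∑ s, visit γ P π ρ s * ((∑ a, |η s a - π s a|) / 2) := by
          rw [Finset.mul_sum, ← Finset.sum_add_distrib]
          refine Finset.sum_congr rfl fun s _ => ?_
          rw [Finset.sum_add_distrib, ← Finset.mul_sum, ← Finset.mul_sum, (hη s).2]
          ring
      _ ≤ _ := by linarith
  have hstate : ∑ s, |visit γ P η ρ s - visit γ P π ρ s|
      ≤ γ * ∑ s, ∑ a, |visit γ P η ρ s * η s a - visit γ P π ρ s * π s a| := by
    calc ∑ s', |visit γ P η ρ s' - visit γ P π ρ s'|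
        ≤ ∑ s', γ * ∑ s, ∑ a,
            |visit γ P η ρ s * η s a - visit γ P π ρ s * π s a| * P s a s' := by
          refine Finset.sum_le_sum fun s' _ => ?_
          have heq : visit γ P η ρ s' - visit γ P π ρ s' = γ * ∑ s, ∑ a,
              (visit γ P η ρ s * η s a - visit γ P π ρ s * π s a) * P s a s' := by
            rw [visit_eq_add_step hγ hγ' hP hη hρ, visit_eq_add_step hγ hγ' hP hπ hρ]
            simp only [step, sub_mul, Finset.sum_sub_distrib]
            ring
          rw [heq, abs_mul, abs_of_nonneg hγ]
          refine mul_le_mul_of_nonneg_left ?_ hγ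
          refine (Finset.abs_sum_le_sum_abs _ _).trans (Finset.sum_le_sum fun s _ => ?_)
          refine (Finset.abs_sum_le_sum_abs _ _).trans (Finset.sum_le_sum fun a _ => ?_)
          rw [abs_mul, abs_of_nonneg ((hP s a).1 s')]
      _ = γ * ∑ s, ∑ a, |visit γ P η ρ s * η s a - visit γ P π ρ s * π s a| := by
          rw [← Finset.mul_sum, Finset.sum_comm]
          congr 1
          refine Finset.sum_congr rfl fun s _ => ?_
          rw [Finset.sum_comm]
          simp only [← Finset.mul_sum, (hP s _).2, mul_one]
  rw [le_div_iff₀ (by linarith)]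
  linarith

theorem expCost_mem_unit {c : S → A → ℝ} {π : S → A → ℝ} {d : S → ℝ}
    (hc : ∀ s a, 0 ≤ c s a ∧ c s a ≤ 1) (hπ : IsPolicy π) (hd : IsDist d) :
    0 ≤ expCost c π d ∧ expCost c π d ≤ 1 := by
  have hw : ∀ s a, 0 ≤ d s * π s a := fun s a => mul_nonneg (hd.1 s) ((hπ s).1 a)
  refine ⟨Finset.sum_nonneg fun s _ => Finset.sum_nonneg fun a _ =>
    mul_nonneg (hw s a) (hc s a).1, ?_⟩
  calc expCost c π d ≤ ∑ s, ∑ a, d s * π s a :=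
        Finset.sum_le_sum fun s _ => Finset.sum_le_sum fun a _ =>
          mul_le_of_le_one_right (hw s a) (hc s a).2
    _ = 1 := by simp only [← Finset.mul_sum, (hπ _).2, mul_one, hd.2]

theorem stateDist_succ_eq (P : S → A → S → ℝ) (π : S → A → ℝ) (ρ : S → ℝ) (t : ℕ) :
    stateDist P π ρ (t + 1) = stateDist P π (step P π ρ) t := by
  induction t with
  | zero => rfl
  | succ t ih => rw [stateDist, ih, stateDist]

theorem step_eq_sum_mul (P : S → A → S → ℝ) (π : S → A → ℝ) (d : S → ℝ) (s' : S) :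
    step P π d s' = ∑ s, d s * ∑ a, π s a * P s a s' := by
  simp only [step, Finset.mul_sum, mul_assoc]

/-- Averaging `f` over a mixture of measures. -/
theorem sum_mixture_mul (w : S → ℝ) (D : S → S → ℝ) (f : S → ℝ) :
    ∑ s, (∑ x, w x * D x s) * f s = ∑ x, w x * ∑ s, D x s * f s := by
  simp only [Finset.sum_mul, Finset.mul_sum, mul_assoc]
  exact Finset.sum_comm

variable [DecidableEq S]

/-- The time-`t` state distribution is the mixture of those started at a point. -/
theorem stateDist_eq_sum_dirac (P : S → A → S → ℝ) (π : S → A → ℝ) (ρ : S → ℝ) (t : ℕ) (s : S) :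
    stateDist P π ρ t s
      = ∑ x, ρ x * stateDist P π (fun y => if y = x then 1 else 0) t s := by
  induction t generalizing s with
  | zero => simp [stateDist]
  | succ t ih =>
    simp only [stateDist, step_eq_sum_mul, ih]
    exact sum_mixture_mul _ _ _

theorem expCost_stateDist_eq_sum_dirac (P : S → A → S → ℝ) (c π : S → A → ℝ) (ρ : S → ℝ)
    (t : ℕ) :
    expCost c π (stateDist P π ρ t)
      = ∑ x, ρ x * expCost c π (stateDist P π (fun y => if y = x then 1 else 0) t) := by
  have h : ∀ d : S → ℝ, expCost c π d = ∑ s, d s * ∑ a, π s a * c s a := fun d => by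
    simp only [expCost, Finset.mul_sum, mul_assoc]
  simp only [h]
  rw [← sum_mixture_mul]
  simp only [← stateDist_eq_sum_dirac P π ρ t]

variable {γ : ℝ} {P : S → A → S → ℝ} {c π : S → A → ℝ}

theorem summable_discounted_expCost (hγ : 0 ≤ γ) (hγ' : γ < 1) (hP : IsDynamics P)
    (hc : ∀ s a, 0 ≤ c s a ∧ c s a ≤ 1) (hπ : IsPolicy π) (s : S) :
    Summable fun t =>
      γ ^ t * expCost c π (stateDist P π (fun y => if y = s then 1 else 0) t) :=
  summable_discounted hγ hγ' fun t =>
    expCost_mem_unit hc hπ ((isDist_ite_eq s).stateDist hP hπ t)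

theorem Vf_mem (hγ : 0 ≤ γ) (hγ' : γ < 1) (hP : IsDynamics P)
    (hc : ∀ s a, 0 ≤ c s a ∧ c s a ≤ 1) (hπ : IsPolicy π) (s : S) :
    0 ≤ Vf γ P c π s ∧ Vf γ P c π s ≤ (1 - γ)⁻¹ := by
  have hu := fun t => expCost_mem_unit hc hπ ((isDist_ite_eq s).stateDist hP hπ t)
  refine ⟨tsum_nonneg fun t => mul_nonneg (pow_nonneg hγ t) (hu t).1, ?_⟩
  rw [← tsum_geometric_of_lt_one hγ hγ']
  exact Summable.tsum_le_tsum (fun t => mul_le_of_le_one_right (pow_nonneg hγ t) (hu t).2)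
    (summable_discounted_expCost hγ hγ' hP hc hπ s) (summable_geometric_of_lt_one hγ hγ')

/-- The Bellman equation for the value function. -/
theorem Vf_eq_sum_Qf (hγ : 0 ≤ γ) (hγ' : γ < 1) (hP : IsDynamics P)
    (hc : ∀ s a, 0 ≤ c s a ∧ c s a ≤ 1) (hπ : IsPolicy π) (s : S) :
    Vf γ P c π s = ∑ a, π s a * Qf γ P c π s a := by
  have hsum := summable_discounted_expCost hγ hγ' hP hc hπ
  have hterm : ∀ t : ℕ,
      γ ^ (t + 1) * expCost c π (stateDist P π (fun y => if y = s then 1 else 0) (t + 1))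
      = ∑ x, γ * step P π (fun y => if y = s then 1 else 0) x *
          (γ ^ t * expCost c π (stateDist P π (fun y => if y = x then 1 else 0) t)) := by
    intro t
    rw [stateDist_succ_eq, expCost_stateDist_eq_sum_dirac, Finset.mul_sum]
    refine Finset.sum_congr rfl fun x _ => ?_
    ring
  have htail : ∑' t : ℕ,
      γ ^ (t + 1) * expCost c π (stateDist P π (fun y => if y = s then 1 else 0) (t + 1))
      = γ * ∑ x, step P π (fun y => if y = s then 1 else 0) x * Vf γ P c π x := by
    simp only [hterm]
    rw [Summable.tsum_finsetSum fun x _ => (hsum x).mul_left _, Finset.mul_sum]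
    simp only [tsum_mul_left, Vf, mul_assoc]
  rw [Vf, (hsum s).tsum_eq_zero_add, htail, sum_step_mul]
  simp only [pow_zero, one_mul, stateDist, expCost, Qf, ite_mul, zero_mul,
    Finset.sum_ite_irrel, Finset.sum_const_zero, Finset.sum_ite_eq', Finset.mem_univ, if_true,
    mul_add, Finset.sum_add_distrib, Finset.mul_sum]
  congr 1
  refine Finset.sum_congr rfl fun a _ => Finset.sum_congr rfl fun x _ => ?_
  ring

/-- The objective under the dynamics `Q`, written through the visitation distribution under `P`. -/
theorem one_sub_mul_Jf (hγ : 0 ≤ γ) (hγ' : γ < 1) {Q : S → A → S → ℝ} {ρ : S → ℝ}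
    (hP : IsDynamics P) (hQ : IsDynamics Q) (hρ : IsDist ρ)
    (hc : ∀ s a, 0 ≤ c s a ∧ c s a ≤ 1) (hπ : IsPolicy π) :
    (1 - γ) * Jf γ Q c ρ π = expCost c π (visit γ P π ρ) +
      γ * ∑ s, ∑ a, visit γ P π ρ s * π s a * ∑ s', (Q s a s' - P s a s') * Vf γ Q c π s' := by
  have hflow : (1 - γ) * Jf γ Q c ρ π = ∑ s, visit γ P π ρ s * Vf γ Q c π s
      - γ * ∑ s, step P π (visit γ P π ρ) s * Vf γ Q c π s := by
    rw [Jf, Finset.mul_sum, Finset.mul_sum, ← Finset.sum_sub_distrib]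
    refine Finset.sum_congr rfl fun s _ => ?_
    linear_combination (-Vf γ Q c π s) * visit_eq_add_step hγ hγ' hP hπ hρ s
  have hbellman : ∑ s, visit γ P π ρ s * Vf γ Q c π s = expCost c π (visit γ P π ρ) +
      γ * ∑ s, ∑ a, visit γ P π ρ s * π s a * ∑ s', Q s a s' * Vf γ Q c π s' := by
    rw [expCost, Finset.mul_sum, ← Finset.sum_add_distrib]
    refine Finset.sum_congr rfl fun s _ => ?_
    rw [Vf_eq_sum_Qf hγ hγ' hQ hc hπ s, Finset.mul_sum, Finset.mul_sum, ← Finset.sum_add_distrib]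
    refine Finset.sum_congr rfl fun a _ => ?_
    rw [Qf]
    ring
  rw [hflow, hbellman, sum_step_mul]
  simp only [sub_mul, Finset.sum_sub_distrib, mul_sub]
  ring

/-- The simulation lemma: the model error in the objective is controlled by the expected total
variation distance between the dynamics. -/
theorem abs_Jf_sub_Jf_le (hγ : 0 ≤ γ) (hγ' : γ < 1) {Q : S → A → S → ℝ} {ρ : S → ℝ}
    (hP : IsDynamics P) (hQ : IsDynamics Q) (hρ : IsDist ρ)
    (hc : ∀ s a, 0 ≤ c s a ∧ c s a ≤ 1) (hπ : IsPolicy π) :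
    |Jf γ Q c ρ π - Jf γ P c ρ π| ≤ γ / (1 - γ) ^ 2 *
      ∑ s, ∑ a, visit γ P π ρ s * π s a * ((∑ s', |Q s a s' - P s a s'|) / 2) := by
  have h1 : 0 < 1 - γ := by linarith
  have hQJ := one_sub_mul_Jf hγ hγ' hP hQ hρ hc hπ
  have hPJ := one_sub_mul_Jf hγ hγ' hP hP hρ hc hπ
  simp only [sub_self, zero_mul, Finset.sum_const_zero, mul_zero, add_zero] at hPJ
  have hdiff : Jf γ Q c ρ π - Jf γ P c ρ π = γ / (1 - γ) *
      ∑ s, ∑ a, visit γ P π ρ s * π s a *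
        ∑ s', (Q s a s' - P s a s') * Vf γ Q c π s' := by
    rw [div_mul_eq_mul_div, eq_div_iff h1.ne']
    linarith
  have hw : ∀ s a, 0 ≤ visit γ P π ρ s * π s a := fun s a =>
    mul_nonneg ((hρ.visit hγ hγ' hP hπ).1 s) ((hπ s).1 a)
  have hbound : |∑ s, ∑ a, visit γ P π ρ s * π s a *
        ∑ s', (Q s a s' - P s a s') * Vf γ Q c π s'| ≤ (1 - γ)⁻¹ *
      ∑ s, ∑ a, visit γ P π ρ s * π s a * ((∑ s', |Q s a s' - P s a s'|) / 2) := by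
    rw [Finset.mul_sum]
    refine (Finset.abs_sum_le_sum_abs _ _).trans (Finset.sum_le_sum fun s _ => ?_)
    rw [Finset.mul_sum]
    refine (Finset.abs_sum_le_sum_abs _ _).trans (Finset.sum_le_sum fun a _ => ?_)
    rw [abs_mul, abs_of_nonneg (hw s a), mul_left_comm]
    exact mul_le_mul_of_nonneg_left
      ((hQ s a).abs_sum_sub_mul_le (hP s a) (Vf_mem hγ hγ' hQ hc hπ)) (hw s a)
  rw [hdiff, abs_mul, abs_of_nonneg (div_nonneg hγ h1.le)]
  refine (mul_le_mul_of_nonneg_left hbound (div_nonneg hγ h1.le)).trans_eq ?_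
  rw [← mul_assoc]
  congr 1
  field_simp

/-- Inside the trust region, the objectives under a `δ`-accurate model and under the true dynamics
are close. -/
theorem abs_Jf_sub_Jf_le_of_trustRegion (hγ : 0 ≤ γ) (hγ' : γ < 1) {Q : S → A → S → ℝ}
    {η : S → A → ℝ} {ρ : S → ℝ} (hP : IsDynamics P) (hQ : IsDynamics Q) (hρ : IsDist ρ)
    (hc : ∀ s a, 0 ≤ c s a ∧ c s a ≤ 1) (hπ : IsPolicy π) (hη : IsPolicy η) {α δ : ℝ}
    (hδ : ∑ s, ∑ a, visit γ P π ρ s * π s a * ((∑ s', |Q s a s' - P s a s'|) / 2) ≤ δ)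
    (hα : ∑ s, visit γ P π ρ s * ((∑ a, |η s a - π s a|) / 2) ≤ α) :
    |Jf γ Q c ρ η - Jf γ P c ρ η| ≤ γ / (1 - γ) ^ 2 * (δ + 2 * α / (1 - γ)) := by
  refine (abs_Jf_sub_Jf_le hγ hγ' hP hQ hρ hc hη).trans
    (mul_le_mul_of_nonneg_left ?_ (div_nonneg hγ (sq_nonneg _)))
  refine le_trans ?_ (add_le_add hδ (sum_abs_visit_mul_sub_le hγ hγ' hP hπ hη hρ hα))
  rw [← Finset.sum_add_distrib]
  refine Finset.sum_le_sum fun s _ => ?_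
  rw [← Finset.sum_add_distrib]
  refine Finset.sum_le_sum fun a _ => ?_
  rw [← sub_le_iff_le_add', ← sub_mul]
  have h0 : 0 ≤ (∑ s', |Q s a s' - P s a s'|) / 2 := by positivity
  exact (mul_le_mul_of_nonneg_right (le_abs_self _) h0).trans
    (mul_le_of_le_one_right (abs_nonneg _) ((hQ s a).half_sum_abs_sub_le_one (hP s a)))

end Dynamics

/-- **Theorem 1.** Suppose the model `P̂` is `δ`-accurate under `d_{π_n} π_n`, `η_n` minimizes
`Ĵ` over the trust region of radius `α` around `π_n`, and `η*_n` minimizes the true cost `J`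
over the same trust region, with `Δ_n(α) = J(π_n) - J(η*_n)`. Then
`J(η_n) ≤ J(π_n) - Δ_n(α) + 2γδ/(1-γ)² + 8γα/(1-γ)³`. -/
theorem dpi_theorem_one
    {S A : Type*} [Fintype S] [Fintype A] [DecidableEq S]
    (γ : ℝ) (P Phat : S → A → S → ℝ) (c : S → A → ℝ) (ρ₀ : S → ℝ)
    (hγ : 0 < γ) (hγ' : γ < 1) (hP : IsDynamics P) (hPhat : IsDynamics Phat) (hρ : IsDist ρ₀)
    (hc : ∀ s a, 0 ≤ c s a ∧ c s a ≤ 1)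
    (πn ηn ηstar : S → A → ℝ)
    (hπn : IsPolicy πn) (hηn : IsPolicy ηn) (hηstar : IsPolicy ηstar)
    (α δ : ℝ) (hα : 0 ≤ α) (hδ : 0 ≤ δ)
    (hmodel : ∑ s, ∑ a, visit γ P πn ρ₀ s * πn s a *
        ((∑ s', |Phat s a s' - P s a s'|) / 2) ≤ δ)
    (hηnT : ∑ s, visit γ P πn ρ₀ s * ((∑ a, |ηn s a - πn s a|) / 2) ≤ α)
    (hηstarT : ∑ s, visit γ P πn ρ₀ s * ((∑ a, |ηstar s a - πn s a|) / 2) ≤ α)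
    (hηnmin : ∀ π : S → A → ℝ, IsPolicy π →
      (∑ s, visit γ P πn ρ₀ s * ((∑ a, |π s a - πn s a|) / 2) ≤ α) →
      Jf γ Phat c ρ₀ ηn ≤ Jf γ Phat c ρ₀ π)
    (hηstarmin : ∀ π : S → A → ℝ, IsPolicy π →
      (∑ s, visit γ P πn ρ₀ s * ((∑ a, |π s a - πn s a|) / 2) ≤ α) →
      Jf γ P c ρ₀ ηstar ≤ Jf γ P c ρ₀ π) :
    Jf γ P c ρ₀ ηn ≤
      Jf γ P c ρ₀ πn - (Jf γ P c ρ₀ πn - Jf γ P c ρ₀ ηstar) +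
        2 * γ * δ / (1 - γ) ^ 2 + 8 * γ * α / (1 - γ) ^ 3 := by
  have h1 : 0 < 1 - γ := by linarith
  have hn := abs_le.1
    (abs_Jf_sub_Jf_le_of_trustRegion hγ.le hγ' hP hPhat hρ hc hπn hηn hmodel hηnT)
  have hstar := abs_le.1
    (abs_Jf_sub_Jf_le_of_trustRegion hγ.le hγ' hP hPhat hρ hc hπn hηstar hmodel hηstarT)
  have hmin := hηnmin ηstar hηstar hηstarT
  have hslack : 0 ≤ 4 * γ * α / (1 - γ) ^ 3 := by positivity
  have hbound : 2 * (γ / (1 - γ) ^ 2 * (δ + 2 * α / (1 - γ))) =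
      2 * γ * δ / (1 - γ) ^ 2 + 8 * γ * α / (1 - γ) ^ 3 - 4 * γ * α / (1 - γ) ^ 3 := by
    field_simp
    ring
  linarith [hn.1, hstar.2]
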